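/- Let n = 3r and let (C, C̄) and (C', C̄') be two equitable partitions of Q_n with quotient matrix [[0,3r],[r,2r]] such that both C and C' are affine subspaces of F_2^n (necessarily of dimension n−2). Then the two partitions are isomorphic: there is a graph automorphism of Q_n mapping C onto C'. -/

import Mathlib

/-- Binary words of length `n`: the vertex set of the hypercube `Q_n`. -/
abbrev BW (n : ℕ) := Fin n → ZMod 2

/-- Adjacency in a Hamming-type graph (hypercube `Q_n`, Hamming graph `H(r,q)`, ...):
two words are adjacent iff they differ in exactly one coordinate. -/
def hAdj {ι : Type*} {β : ι → Type*} [Fintype ι] [∀ i, DecidableEq (β i)]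
    (x y : ∀ i, β i) : Prop :=
  hammingDist x y = 1

/-- `(Cs i)_{i < k}` is an equitable partition of the graph with vertex set `V` and
adjacency relation `adj`, with quotient matrix `S`: the cells are nonempty, every vertex
lies in exactly one cell, and every vertex of `Cs i` has exactly `S i j` neighbors in `Cs j`. -/
def IsEquitablePartition {V : Type*} (adj : V → V → Prop) {k : ℕ}
    (Cs : Fin k → Set V) (S : Fin k → Fin k → ℕ) : Prop :=
  (∀ i, (Cs i).Nonempty) ∧
  (∀ v : V, ∃! i, v ∈ Cs i) ∧
  ∀ i j : Fin k, ∀ v ∈ Cs i, {w | w ∈ Cs j ∧ adj v w}.ncard = S i j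

/-- `α` is an automorphism (isometry) of the hypercube `Q_n`. -/
def IsCubeAut {n : ℕ} (α : BW n ≃ BW n) : Prop :=
  ∀ x y : BW n, hAdj (α x) (α y) ↔ hAdj x y

open Classical in
theorem hAdj_iff_single {n : ℕ} (v w : BW n) :
    hAdj v w ↔ ∃ i, w = v + Pi.single i (1 : ZMod 2) := by
  have h2 : ∀ a b : ZMod 2, a ≠ b → b = a + 1 := by decide
  unfold hAdj hammingDist
  rw [Finset.card_eq_one]
  constructor
  · rintro ⟨i, hi⟩
    refine ⟨i, ?_⟩
    ext j
    have hj := congrArg (fun s => j ∈ s) hi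
    simp only [Finset.mem_filter, Finset.mem_univ, true_and, Finset.mem_singleton,
      eq_iff_iff] at hj
    by_cases hji : j = i
    · subst hji
      simpa using h2 _ _ (hj.2 rfl)
    · simp only [hji, iff_false, not_not] at hj
      simp [Pi.single_eq_of_ne hji, hj]
  · rintro ⟨i, rfl⟩
    refine ⟨i, ?_⟩
    ext j
    by_cases hji : j = i
    · subst hji; simp
    · simp [hji]

theorem ncard_nbrs {n : ℕ} (C : Set (BW n)) (v : BW n) :
    {w | w ∈ C ∧ hAdj v w}.ncard = {i : Fin n | v + Pi.single i (1 : ZMod 2) ∈ C}.ncard := by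
  have hinj : Function.Injective (fun i : Fin n => v + Pi.single i (1 : ZMod 2)) := by
    intro i j h
    have h1 : (Pi.single i (1 : ZMod 2) : BW n) = Pi.single j 1 := add_left_cancel h
    by_contra hij
    have := congrFun h1 i
    simp [Pi.single_eq_of_ne hij] at this
  rw [← Set.ncard_image_of_injective _ hinj]
  congr 1
  ext w
  simp only [Set.mem_ofPred_eq, hAdj_iff_single, Set.mem_image]
  constructor
  · rintro ⟨h, i, rfl⟩; exact ⟨i, h, rfl⟩
  · rintro ⟨i, h, rfl⟩; exact ⟨h, i, rfl⟩

open Classical in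
theorem struct_lemma {n r : ℕ} (C : Set (BW n))
    (hC : IsEquitablePartition hAdj ![C, Cᶜ] ![![0, 3*r], ![r, 2*r]])
    (haff : ∃ s : AffineSubspace (ZMod 2) (BW n), C = (s : Set (BW n))) :
    ∃ (V : Submodule (ZMod 2) (BW n)) (c : BW n), (∀ x, x ∈ C ↔ x - c ∈ V) ∧
      (∀ w : BW n ⧸ V, {i : Fin n | V.mkQ (Pi.single i (1 : ZMod 2)) = w}.ncard
        = if w = 0 then 0 else r) := by
  obtain ⟨s, rfl⟩ := haff
  obtain ⟨hne, -, hS⟩ := hC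
  obtain ⟨c, hc⟩ := hne 0
  have hc : c ∈ s := by simpa using hc
  have hm : ∀ x, x ∈ (s : Set (BW n)) ↔ x - c ∈ s.direction := by
    intro x
    have := AffineSubspace.vsub_right_mem_direction_iff_mem hc x
    simpa using this.symm
  have hneg : ∀ x : BW n, -x = x := fun x => by
    ext i; exact ZMod.neg_eq_self_mod_two (x i)
  refine ⟨s.direction, c, hm, ?_⟩
  intro w
  obtain ⟨y, rfl⟩ := s.direction.mkQ_surjective w
  have key : {i : Fin n | s.direction.mkQ (Pi.single i (1 : ZMod 2)) = s.direction.mkQ y}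
      = {i : Fin n | (c + y) + Pi.single i (1 : ZMod 2) ∈ (s : Set (BW n))} := by
    ext i
    simp only [Set.mem_ofPred_eq, hm, Submodule.mkQ_apply]
    rw [Submodule.Quotient.eq]
    have : c + y + Pi.single i (1 : ZMod 2) - c = Pi.single i (1 : ZMod 2) - y := by
      rw [sub_eq_add_neg _ y, hneg y]; abel
    rw [this]
  rw [key, ← ncard_nbrs]
  have hy : s.direction.mkQ y = 0 ↔ c + y ∈ (s : Set (BW n)) := by
    rw [hm]; simp
  split_ifs with h
  · simpa using hS 0 0 (c + y) (by simpa using hy.1 h)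
  · simpa using hS 1 0 (c + y) (by simpa using fun h' => h (hy.2 h'))

theorem exists_perm_of_fibers {n : ℕ} {W : Type*} (f g : Fin n → W)
    (h : ∀ w, {i | f i = w}.ncard = {i | g i = w}.ncard) :
    ∃ σ : Equiv.Perm (Fin n), ∀ i, g (σ i) = f i := by
  have e : ∀ w, Nonempty ({i // f i = w} ≃ {i // g i = w}) := fun w => by
    classical
    exact ⟨Fintype.equivOfCardEq (by
      have := h w
      rwa [← Nat.card_coe_set_eq, ← Nat.card_coe_set_eq, Nat.card_eq_fintype_card,
        Nat.card_eq_fintype_card] at this)⟩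
  replace e := fun w => Classical.choice (e w)
  refine ⟨(Equiv.sigmaFiberEquiv f).symm.trans
    ((Equiv.sigmaCongrRight e).trans (Equiv.sigmaFiberEquiv g)), fun i => ?_⟩
  exact (e (f i) ⟨i, rfl⟩).2

open Classical in
theorem card_quot {n r : ℕ} (hn : n = 3 * r) (hr : 0 < r) (V : Submodule (ZMod 2) (BW n))
    (h : ∀ w : BW n ⧸ V, {i : Fin n | V.mkQ (Pi.single i (1 : ZMod 2)) = w}.ncard
        = if w = 0 then 0 else r) : Nat.card (BW n ⧸ V) = 4 := by
  have : Finite (BW n ⧸ V) := Finite.of_surjective _ V.mkQ_surjective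
  have := Fintype.ofFinite (BW n ⧸ V)
  have h1 := Finset.card_eq_sum_card_fiberwise (s := (Finset.univ : Finset (Fin n)))
    (t := (Finset.univ : Finset (BW n ⧸ V)))
    (f := fun i => V.mkQ (Pi.single i (1 : ZMod 2))) (by simp)
  have h2 : ∀ w : BW n ⧸ V, (Finset.univ.filter
      (fun i : Fin n => V.mkQ (Pi.single i (1 : ZMod 2)) = w)).card = if w = 0 then 0 else r := by
    intro w
    rw [← h w, ← Set.ncard_coe_finset, Finset.coe_filter]
    congr 1
    ext i
    simp
  rw [Finset.sum_congr rfl (fun w _ => h2 w), Finset.sum_ite] at h1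
  simp only [Finset.sum_const_zero, zero_add, Finset.sum_const, smul_eq_mul, Finset.card_univ,
    Fintype.card_fin, Finset.filter_ne', Finset.card_erase_of_mem (Finset.mem_univ _)] at h1
  have h3 := Nat.eq_of_mul_eq_mul_right hr (hn.symm.trans h1)
  rw [Nat.card_eq_fintype_card]
  omega

theorem mkQ_eq_sum {n : ℕ} (V : Submodule (ZMod 2) (BW n)) (x : BW n) :
    V.mkQ x = ∑ i, x i • V.mkQ (Pi.single i (1 : ZMod 2)) := by
  conv_lhs => rw [pi_eq_sum_univ' x]
  rw [map_sum]
  refine Finset.sum_congr rfl fun i _ => ?_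
  rw [map_smul]

theorem stmt_7 (n r : ℕ) (hn : n = 3 * r) (C C' : Set (BW n))
    (hC : IsEquitablePartition hAdj ![C, Cᶜ] ![![0, 3*r], ![r, 2*r]])
    (hC' : IsEquitablePartition hAdj ![C', C'ᶜ] ![![0, 3*r], ![r, 2*r]])
    (haff : ∃ s : AffineSubspace (ZMod 2) (BW n), C = (s : Set (BW n)))
    (haff' : ∃ s : AffineSubspace (ZMod 2) (BW n), C' = (s : Set (BW n))) :
    ∃ α : BW n ≃ BW n, IsCubeAut α ∧ α '' C = C' := by
  have hr : 0 < r := by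
    rcases Nat.eq_zero_or_pos r with h | h
    · exfalso
      subst h
      subst hn
      obtain ⟨x, hx⟩ := hC.1 0
      obtain ⟨y, hy⟩ := hC.1 1
      have : x = y := by ext i; exact i.elim0
      subst this
      simp at hx hy
      exact hy hx
    · exact h
  obtain ⟨V, c, hV, hf⟩ := struct_lemma C hC haff
  obtain ⟨V', c', hV', hf'⟩ := struct_lemma C' hC' haff'
  have hk := card_quot hn hr V hf
  have hk' := card_quot hn hr V' hf'
  have hrank : Module.finrank (ZMod 2) (BW n ⧸ V) = Module.finrank (ZMod 2) (BW n ⧸ V') := by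
    have h1 := Module.natCard_eq_pow_finrank (K := ZMod 2) (V := BW n ⧸ V)
    have h2 := Module.natCard_eq_pow_finrank (K := ZMod 2) (V := BW n ⧸ V')
    rw [hk] at h1
    rw [hk', h1] at h2
    simp only [Nat.card_zmod] at h2
    exact Nat.pow_right_injective le_rfl h2
  let φ := LinearEquiv.ofFinrankEq (BW n ⧸ V) (BW n ⧸ V') hrank
  obtain ⟨σ, hσ⟩ := exists_perm_of_fibers
    (fun i => φ (V.mkQ (Pi.single i (1 : ZMod 2))))
    (fun i => V'.mkQ (Pi.single i (1 : ZMod 2))) (by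
      intro w
      rw [hf' w]
      have := hf (φ.symm w)
      simp only [← φ.eq_symm_apply] at this ⊢
      rw [this]
      have hz : φ.symm w = 0 ↔ w = 0 := φ.symm.map_eq_zero_iff
      by_cases hw : w = 0
      · rw [if_pos hw, if_pos (hz.2 hw)]
      · rw [if_neg hw, if_neg (fun h => hw (hz.1 h))])
  have hmem : ∀ y : BW n, (fun j => y (σ.symm j)) ∈ V' ↔ y ∈ V := by
    intro y
    have e1 : V'.mkQ (fun j => y (σ.symm j)) = φ (V.mkQ y) := by
      rw [mkQ_eq_sum V' , mkQ_eq_sum V y, map_sum, ← Equiv.sum_comp σ]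
      refine Finset.sum_congr rfl fun i _ => ?_
      rw [map_smul, ← hσ i]
      simp
    rw [← Submodule.Quotient.mk_eq_zero V', ← Submodule.mkQ_apply, e1,
      ← Submodule.Quotient.mk_eq_zero V, ← Submodule.mkQ_apply]
    simp only [EmbeddingLike.map_eq_zero_iff]
  let α : BW n ≃ BW n := (Equiv.subRight c).trans
    ((Equiv.arrowCongr σ (Equiv.refl (ZMod 2))).trans (Equiv.addRight c'))
  have hα : ∀ x, α x = (fun j => (x - c) (σ.symm j)) + c' := fun x => rfl
  refine ⟨α, ?_, ?_⟩
  · intro x y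
    unfold hAdj
    have : hammingDist (α x) (α y) = hammingDist x y := by
      unfold hammingDist
      refine Finset.card_equiv σ.symm fun j => ?_
      simp [hα]
    rw [this]
  · ext z
    rw [Equiv.image_eq_preimage_symm, Set.mem_preimage, hV]
    obtain ⟨x, rfl⟩ := α.surjective z
    rw [Equiv.symm_apply_apply, hV', hα, add_sub_cancel_right, hmem]
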